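/- Let X be a simple Markov chain. Then the following are equivalent: (i) X is asymptotically aperiodic; (ii) X^(m) is simple for all m > 1; (iii) X^(m) is simple for all prime numbers m. -/

import Mathlib

open MeasureTheory Filter Set ProbabilityTheory

/-- A discrete-time Markov chain on a state space `S`: a stochastic transition
matrix `P`, an initial distribution `init`, and the induced probability measure
`μ` on the path space `ℕ → S`, determined by its values on cylinder sets. -/
structure MarkovChain (S : Type) [MeasurableSpace S] where
  P : S → S → ℝ
  P_nonneg : ∀ i j, 0 ≤ P i j
  P_stochastic : ∀ i, HasSum (P i) 1
  init : S → ℝ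
  init_nonneg : ∀ i, 0 ≤ init i
  init_hasSum : HasSum init 1
  μ : Measure (ℕ → S)
  μ_prob : IsProbabilityMeasure μ
  μ_cylinder : ∀ (n : ℕ) (s : ℕ → S),
    μ {ω | ∀ k ≤ n, ω k = s k}
      = ENNReal.ofReal (init (s 0) * ∏ k ∈ Finset.range n, P (s k) (s (k + 1)))

namespace MarkovChain

variable {S : Type} [MeasurableSpace S]

open Classical in
/-- The `n`-step transition probabilities `P^n(i,j)`. -/
noncomputable def Pn (X : MarkovChain S) : ℕ → S → S → ℝ
  | 0, i, j => if i = j then 1 else 0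
  | n + 1, i, j => ∑' k : S, X.Pn n i k * X.P k j

/-- Irreducibility: every state can be reached from every state. -/
def Irreducible (X : MarkovChain S) : Prop := ∀ i j : S, ∃ n : ℕ, 0 < X.Pn n i j

/-- Aperiodicity: for each state, the gcd of the set `{n ≥ 1 | P^n(i,i) > 0}`
is `1` (expressed via common divisors). -/
def Aperiodic (X : MarkovChain S) : Prop :=
  ∀ i : S, ∀ d : ℕ, (∀ n : ℕ, 0 < n → 0 < X.Pn n i i → d ∣ n) → d = 1

/-- `U^(m)(C)`: the event that the `m`-step chain visits `C` infinitely often. -/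
def U (X : MarkovChain S) (m : ℕ) (C : Set S) : Set (ℕ → S) :=
  {ω | ∀ n : ℕ, ∃ k : ℕ, n ≤ k ∧ ω (k * m) ∈ C}

/-- `L^(m)(C)`: the event that the `m`-step chain is eventually in `C`. -/
def L (X : MarkovChain S) (m : ℕ) (C : Set S) : Set (ℕ → S) :=
  {ω | ∃ n : ℕ, ∀ k : ℕ, n ≤ k → ω (k * m) ∈ C}

/-- `C` is transient with respect to the `m`-step chain `X^(m)`. -/
def Transient (X : MarkovChain S) (m : ℕ) (C : Set S) : Prop := X.μ (X.U m C) = 0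

/-- `C` is regular with respect to `X^(m)`: `U^(m)(C)` and `L^(m)(C)` agree up
to a null event. -/
def Regular (X : MarkovChain S) (m : ℕ) (C : Set S) : Prop :=
  X.μ (symmDiff (X.U m C) (X.L m C)) = 0

/-- `C` is almost closed with respect to `X^(m)`: regular but not transient. -/
def AlmostClosed (X : MarkovChain S) (m : ℕ) (C : Set S) : Prop :=
  X.Regular m C ∧ ¬ X.Transient m C

/-- An almost closed set is atomic if it does not contain two disjoint almost
closed subsets. -/
def Atomic (X : MarkovChain S) (m : ℕ) (C : Set S) : Prop :=
  X.AlmostClosed m C ∧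
    ¬ ∃ A B : Set S, A ⊆ C ∧ B ⊆ C ∧ Disjoint A B ∧
      X.AlmostClosed m A ∧ X.AlmostClosed m B

/-- A Blackwell decomposition for the `m`-step chain `X^(m)`: a countable
collection of pairwise disjoint almost closed sets, all atomic except at most
one, where a nonatomic member contains no atomic subsets and consists of
transient states, and such that the probabilities `μ(L^(m)(C))` sum to one. -/
structure IsBlackwell (X : MarkovChain S) (m : ℕ) (𝒞 : Set (Set S)) : Prop where
  countable : 𝒞.Countable
  almostClosed : ∀ C ∈ 𝒞, X.AlmostClosed m C
  disjoint : 𝒞.PairwiseDisjoint id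
  atMostOneNonatomic : ∀ C₁ ∈ 𝒞, ∀ C₂ ∈ 𝒞, ¬ X.Atomic m C₁ → ¬ X.Atomic m C₂ → C₁ = C₂
  nonatomicNoAtomicSubset : ∀ C ∈ 𝒞, ¬ X.Atomic m C → ∀ A : Set S, A ⊆ C → ¬ X.Atomic m A
  nonatomicTransientStates : ∀ C ∈ 𝒞, ¬ X.Atomic m C → ∀ i ∈ C, X.Transient m {i}
  sum_L_eq_one : ∑' C : 𝒞, X.μ (X.L m (C : Set S)) = 1

/-- `β(X^(m))`: the number of sets in a Blackwell decomposition for `X^(m)`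
(well defined since the decomposition is unique up to equivalence). -/
noncomputable def beta (X : MarkovChain S) (m : ℕ) : ℕ∞ :=
  sInf (Set.encard '' {𝒞 : Set (Set S) | X.IsBlackwell m 𝒞})

/-- `X` is simple if `β(X) = 1`. -/
def Simple (X : MarkovChain S) : Prop := X.beta 1 = 1

/-- The asymptotic period `d(X) = sup {m ≥ 1 | β(X^(m)) = m}` (possibly `∞`). -/
noncomputable def period (X : MarkovChain S) : ℕ∞ :=
  sSup {d : ℕ∞ | ∃ m : ℕ, 1 ≤ m ∧ X.beta m = (m : ℕ∞) ∧ d = (m : ℕ∞)}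

/-- Recurrence: every state is visited infinitely often almost surely. -/
def Recurrent (X : MarkovChain S) : Prop := ∀ i : S, X.μ (X.U 1 {i}) = 1

end MarkovChain

/-- The shift operator `θ` on path space: `(θ ω)(n) = ω(n+1)`. -/
def pathShift {S : Type} : (ℕ → S) → ℕ → S := fun ω n => ω (n + 1)

/-- An event `E` is `m`-invariant if its indicator function `f` satisfies
`f(ω) = f(θ^m ω)` for all paths `ω`. -/
def MInvariant {S : Type} (m : ℕ) (E : Set (ℕ → S)) : Prop :=
  ∀ ω : ℕ → S, ω ∈ E ↔ pathShift^[m] ω ∈ E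

/-- A birth-death process: a Markov chain on `ℕ` with positive birth
probabilities `p_i = P(i,i+1)`, positive death probabilities `q_{i+1} = P(i+1,i)`,
all transition probabilities other than `p_i`, `q_i` and `r_i = P(i,i)` zero,
and at least one positive self-transition probability. -/
structure MarkovChain.IsBirthDeath (X : MarkovChain ℕ) : Prop where
  birth_pos : ∀ i : ℕ, 0 < X.P i (i + 1)
  death_pos : ∀ i : ℕ, 0 < X.P (i + 1) i
  tridiagonal : ∀ i j : ℕ, 1 < |(i : ℤ) - (j : ℤ)| → X.P i j = 0
  self_pos : ∃ i : ℕ, 0 < X.P i i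

namespace MarkovChain

section AsymptoticPeriod

variable {S : Type}

lemma pathShift_iterate_apply (m : ℕ) (ω : ℕ → S) (n : ℕ) :
    pathShift^[m] ω n = ω (n + m) := by
  induction m generalizing ω with
  | zero => rfl
  | succ m ih =>
    rw [Function.iterate_succ_apply, ih, pathShift]
    congr 1

/-- The cylinder of paths that agree with `s` up to time `n`. -/
def cyl (s : ℕ → S) (n : ℕ) : Set (ℕ → S) := {ω | ∀ k ≤ n, ω k = s k}

lemma cyl_eq_of_mem {s t : ℕ → S} {n : ℕ} (h : t ∈ cyl s n) : cyl t n = cyl s n := by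
  ext ω
  exact ⟨fun hω k hk => (hω k hk).trans (h k hk), fun hω k hk => (hω k hk).trans (h k hk).symm⟩

lemma countable_range_cyl [Countable S] (n : ℕ) :
    (Set.range fun s : ℕ → S => cyl s n).Countable := by
  refine (Set.countable_range
    fun g : Fin (n + 1) → S => {ω : ℕ → S | ∀ k : Fin (n + 1), ω k = g k}).mono ?_
  rintro _ ⟨s, rfl⟩
  refine ⟨fun k => s k, ?_⟩
  ext ω
  exact ⟨fun h k hk => h ⟨k, Nat.lt_succ_of_le hk⟩, fun h k => h k (Nat.le_of_lt_succ k.2)⟩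

/-- `A` depends only on the coordinates up to time `n`. -/
def Determined (n : ℕ) (A : Set (ℕ → S)) : Prop := ∀ ω ∈ A, cyl ω n ⊆ A

lemma Determined.eq_biUnion {n : ℕ} {A : Set (ℕ → S)} (hA : Determined n A) :
    A = ⋃ c ∈ (fun s => cyl s n) '' A, c := by
  ext ω
  simp only [mem_iUnion, exists_prop, mem_image]
  constructor
  · exact fun h => ⟨_, ⟨ω, h, rfl⟩, fun k _ => rfl⟩
  · rintro ⟨_, ⟨s, hs, rfl⟩, hω⟩
    exact hA s hs hω

lemma pairwiseDisjoint_cyl (n : ℕ) (A : Set (ℕ → S)) :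
    ((fun s => cyl s n) '' A).PairwiseDisjoint id := by
  rintro _ ⟨s, -, rfl⟩ _ ⟨t, -, rfl⟩ hne
  refine Set.disjoint_left.2 fun ω hs ht => hne ?_
  exact (cyl_eq_of_mem hs).symm.trans (cyl_eq_of_mem ht)

/-- The path following `s` up to time `n` and `u` afterwards. -/
def splice (s : ℕ → S) (n : ℕ) (u : ℕ → S) : ℕ → S := fun k => if k ≤ n then s k else u (k - n)

lemma splice_of_le (s u : ℕ → S) {n k : ℕ} (h : k ≤ n) : splice s n u k = s k := if_pos h

lemma splice_add {s u : ℕ → S} {n : ℕ} (h : s n = u 0) (k : ℕ) : splice s n u (n + k) = u k := by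
  rcases Nat.eq_zero_or_pos k with rfl | hk
  · simp [splice, h]
  · rw [splice, if_neg (by omega)]
    congr 1
    omega

lemma cyl_inter_preimage {s u : ℕ → S} {n : ℕ} (h : s n = u 0) (l : ℕ) :
    cyl s n ∩ pathShift^[n] ⁻¹' cyl u l = cyl (splice s n u) (n + l) := by
  ext ω
  simp only [cyl, mem_inter_iff, mem_ofPred_eq, mem_preimage, pathShift_iterate_apply]
  constructor
  · rintro ⟨h1, h2⟩ k hk
    rcases le_or_gt k n with hkn | hkn
    · rw [splice_of_le _ _ hkn, h1 k hkn]
    · obtain ⟨j, rfl⟩ := Nat.exists_eq_add_of_lt hkn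
      have := h2 (j + 1) (by omega)
      rw [add_assoc, splice_add h, ← this]
      congr 1
      omega
  · intro hω
    refine ⟨fun k hk => ?_, fun k hk => ?_⟩
    · rw [hω k (by omega), splice_of_le _ _ hk]
    · rw [add_comm k n, hω (n + k) (by omega), splice_add h]

/-- The cylinders, together with the empty set. -/
def cylinders : Set (Set (ℕ → S)) := {A | A = ∅ ∨ ∃ s n, A = cyl s n}

lemma isPiSystem_cylinders : IsPiSystem (cylinders (S := S)) := by
  rintro _ (rfl | ⟨s, n, rfl⟩) _ (rfl | ⟨t, k, rfl⟩) ⟨ω, hω⟩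
  · exact absurd hω.1 (notMem_empty _)
  · exact absurd hω.1 (notMem_empty _)
  · exact absurd hω.2 (notMem_empty _)
  · refine Or.inr ⟨ω, max n k, ?_⟩
    rw [← cyl_eq_of_mem hω.1, ← cyl_eq_of_mem hω.2]
    ext η
    simp only [cyl, mem_inter_iff, mem_ofPred_eq]
    refine ⟨fun h j hj => ?_, fun h => ⟨fun j hj => h j (by omega), fun j hj => h j (by omega)⟩⟩
    rcases le_max_iff.1 hj with hj | hj
    · exact h.1 j hj
    · exact h.2 j hj

lemma Determined.measurableSet_of_cylinders [Countable S] {m : MeasurableSpace (ℕ → S)}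
    {n : ℕ} (hm : ∀ s, MeasurableSet[m] (cyl (S := S) s n)) {A : Set (ℕ → S)}
    (hA : Determined n A) : MeasurableSet[m] A := by
  rw [hA.eq_biUnion]
  refine MeasurableSet.biUnion ((countable_range_cyl n).mono (Set.image_subset_range _ _)) ?_
  rintro _ ⟨s, -, rfl⟩
  exact hm s

/-- The union of the first `n` shifts of `E` by multiples of `d`. -/
def orbit (d n : ℕ) (E : Set (ℕ → S)) : Set (ℕ → S) := ⋃ r < n, pathShift^[r * d] ⁻¹' E

lemma mem_orbit {d n : ℕ} {E : Set (ℕ → S)} {ω : ℕ → S} :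
    ω ∈ orbit d n E ↔ ∃ r < n, pathShift^[r * d] ω ∈ E := by
  simp [orbit]

lemma subset_orbit {d n : ℕ} (hn : 0 < n) (E : Set (ℕ → S)) : E ⊆ orbit d n E :=
  fun _ hω => mem_orbit.2 ⟨0, hn, by simpa using hω⟩

variable [MeasurableSpace S]

lemma measurable_pathShift_iterate (m : ℕ) :
    Measurable (pathShift^[m] : (ℕ → S) → ℕ → S) := by
  refine measurable_pi_lambda _ fun n => ?_
  simp only [pathShift_iterate_apply]
  exact measurable_pi_apply _

section Measurability

variable [MeasurableSingletonClass S]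

lemma measurableSet_cyl (s : ℕ → S) (n : ℕ) : MeasurableSet (cyl s n) := by
  have : cyl s n = ⋂ k ∈ {k | k ≤ n}, (fun ω : ℕ → S => ω k) ⁻¹' {s k} := by
    ext ω; simp [cyl]
  rw [this]
  exact MeasurableSet.biInter (Set.to_countable _) fun k _ =>
    measurable_pi_apply k (measurableSet_singleton _)

lemma generateFrom_cylinders [Countable S] :
    (MeasurableSpace.pi : MeasurableSpace (ℕ → S)) = MeasurableSpace.generateFrom cylinders := by
  apply le_antisymm
  · refine iSup_le fun n => ?_
    rintro _ ⟨B, -, rfl⟩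
    refine Determined.measurableSet_of_cylinders (n := n)
      (fun s => MeasurableSpace.measurableSet_generateFrom (Or.inr ⟨s, n, rfl⟩)) ?_
    intro ω hω η hη
    rw [mem_preimage, hη n le_rfl]
    exact hω
  · refine MeasurableSpace.generateFrom_le ?_
    rintro _ (rfl | ⟨s, n, rfl⟩)
    · exact MeasurableSet.empty
    · exact measurableSet_cyl s n

end Measurability

instance (X : MarkovChain S) : IsProbabilityMeasure X.μ := X.μ_prob

lemma measure_cyl (X : MarkovChain S) (s : ℕ → S) (n : ℕ) :
    X.μ (cyl s n) =
      ENNReal.ofReal (X.init (s 0) * ∏ k ∈ Finset.range n, X.P (s k) (s (k + 1))) :=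
  X.μ_cylinder n s

lemma measure_cyl_inter_preimage_cyl (X : MarkovChain S) {s u : ℕ → S} {n : ℕ} (h : s n = u 0)
    (l : ℕ) : X.μ (cyl s n ∩ pathShift^[n] ⁻¹' cyl u l) =
      X.μ (cyl s n) * ENNReal.ofReal (∏ k ∈ Finset.range l, X.P (u k) (u (k + 1))) := by
  rw [cyl_inter_preimage h, measure_cyl, measure_cyl, ← ENNReal.ofReal_mul
    (mul_nonneg (X.init_nonneg _) (Finset.prod_nonneg fun _ _ => X.P_nonneg _ _)),
    Finset.prod_range_add, splice_of_le _ _ (Nat.zero_le n), mul_assoc]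
  congr 3
  · refine Finset.prod_congr rfl fun k hk => ?_
    rw [Finset.mem_range] at hk
    rw [splice_of_le _ _ hk.le, splice_of_le _ _ hk]
  · refine Finset.prod_congr rfl fun k _ => ?_
    rw [add_assoc, splice_add h, splice_add h]

/-- `n`-step accessibility along a path of positive probability. -/
def Reach (X : MarkovChain S) (n : ℕ) (i j : S) : Prop :=
  ∃ s : ℕ → S, s 0 = i ∧ s n = j ∧ ∀ k < n, 0 < X.P (s k) (s (k + 1))

lemma Reach.trans {X : MarkovChain S} {a b : ℕ} {i j k : S} (h₁ : X.Reach a i j)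
    (h₂ : X.Reach b j k) : X.Reach (a + b) i k := by
  obtain ⟨s, rfl, rfl, hs⟩ := h₁
  obtain ⟨u, hu, rfl, hu'⟩ := h₂
  refine ⟨splice s a u, splice_of_le _ _ (Nat.zero_le _), splice_add hu.symm _, fun l hl => ?_⟩
  rcases lt_or_ge l a with h | h
  · rw [splice_of_le _ _ h.le, splice_of_le _ _ h]
    exact hs l h
  · obtain ⟨j, rfl⟩ := Nat.exists_eq_add_of_le h
    rw [add_assoc, splice_add hu.symm, splice_add hu.symm]
    exact hu' j (by omega)

lemma reach_of_Pn_pos (X : MarkovChain S) {n : ℕ} {i j : S} (h : 0 < X.Pn n i j) :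
    X.Reach n i j := by
  induction n generalizing j with
  | zero =>
    have hij : i = j := by
      by_contra hne
      simp [Pn, hne] at h
    exact ⟨fun _ => i, rfl, hij, by simp⟩
  | succ n ih =>
    obtain ⟨k, hk⟩ : ∃ k, 0 < X.Pn n i k * X.P k j := by
      by_contra! hcon
      exact absurd h (not_lt.2 (tsum_nonpos hcon))
    have hP : 0 < X.P k j := by
      refine lt_of_le_of_ne (X.P_nonneg k j) fun h0 => ?_
      simp [← h0] at hk
    refine (ih (pos_of_mul_pos_left hk hP.le)).trans (b := 1)
      ⟨fun l => if l = 0 then k else j, rfl, rfl, fun l hl => ?_⟩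
    obtain rfl : l = 0 := by omega
    simpa using hP

/-- Irreducibility of the `m`-step chain of an irreducible aperiodic chain. -/
lemma exists_reach_mul (X : MarkovChain S) (hirr : X.Irreducible) (hap : X.Aperiodic) {m : ℕ}
    (hm : 0 < m) (i j : S) : ∃ k, X.Reach (k * m) i j := by
  have hmul (a : ℕ) (ha : X.Reach a i i) (n : ℕ) : X.Reach (n * a) i i := by
    induction n with
    | zero => exact ⟨fun _ => i, rfl, rfl, by simp⟩
    | succ n ih => rw [Nat.succ_mul]; exact ih.trans ha
  let G : AddSubgroup ℤ :=
    { carrier := {z | ∃ n : ℕ, X.Reach n i i ∧ (m : ℤ) ∣ n - z}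
      zero_mem' := ⟨0, ⟨fun _ => i, rfl, rfl, by simp⟩, by simp⟩
      add_mem' := by
        rintro a b ⟨n, hn, hna⟩ ⟨k, hk, hkb⟩
        refine ⟨n + k, hn.trans hk, ?_⟩
        have h1 : ((n + k : ℕ) : ℤ) - (a + b) = (n - a) + (k - b) := by
          push_cast
          ring
        rw [h1]
        exact dvd_add hna hkb
      neg_mem' := by
        rintro a ⟨n, hn, hna⟩
        refine ⟨(m - 1) * n, hmul n hn _, ?_⟩
        have h1 : (((m - 1) * n : ℕ) : ℤ) - -a = m * n - (n - a) := by
          rw [Nat.cast_mul, Nat.cast_sub hm]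
          push_cast
          ring
        rw [h1]
        exact dvd_sub (dvd_mul_right _ _) hna }
  obtain ⟨d, hd⟩ := Int.subgroup_cyclic G
  have hmem (n : ℕ) (hn : X.Reach n i i) : (n : ℤ) ∈ G := ⟨n, hn, by simp⟩
  have hd1 : d.natAbs = 1 := by
    refine hap i _ fun n _ hn => ?_
    have := hmem n (reach_of_Pn_pos X hn)
    rw [hd, AddSubgroup.mem_closure_singleton] at this
    obtain ⟨c, hc⟩ := this
    have hdvd : d ∣ (n : ℤ) := ⟨c, by rw [← hc, smul_eq_mul, mul_comm]⟩
    simpa using Int.natAbs_dvd_natAbs.2 hdvd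
  have hall (z : ℤ) : z ∈ G := by
    rw [hd, AddSubgroup.mem_closure_singleton]
    refine ⟨z * d, ?_⟩
    have : d * d = 1 := by
      rw [← Int.natAbs_mul_self, hd1]; rfl
    rw [smul_eq_mul, mul_assoc, this, mul_one]
  obtain ⟨b, hb⟩ := hirr i j
  obtain ⟨n, hn, k, hk⟩ := hall (-b)
  refine ⟨k.toNat, ?_⟩
  have : k.toNat * m = n + b := by
    have h0 : 0 ≤ k := by
      by_contra! hneg
      nlinarith
    zify
    rw [Int.toNat_of_nonneg h0]
    linarith
  rw [this]
  exact hn.trans (reach_of_Pn_pos X hb)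

/-- A measurable event that is invariant under the `m`-step shift. -/
def InvSet (m : ℕ) (E : Set (ℕ → S)) : Prop := MInvariant m E ∧ MeasurableSet E

lemma InvSet.preimage_mul {m : ℕ} {E : Set (ℕ → S)} (h : InvSet m E) (k : ℕ) :
    pathShift^[k * m] ⁻¹' E = E := by
  induction k with
  | zero => simp
  | succ k ih =>
    ext ω
    rw [Nat.succ_mul, mem_preimage, Function.iterate_add_apply, ← mem_preimage (s := E), ih]
    exact (h.1 ω).symm

lemma InvSet.compl {m : ℕ} {E : Set (ℕ → S)} (hE : InvSet m E) : InvSet m Eᶜ :=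
  ⟨fun ω => not_congr (hE.1 ω), hE.2.compl⟩

lemma InvSet.inter {m : ℕ} {E F : Set (ℕ → S)} (hE : InvSet m E) (hF : InvSet m F) :
    InvSet m (E ∩ F) :=
  ⟨fun ω => and_congr (hE.1 ω) (hF.1 ω), hE.2.inter hF.2⟩

lemma InvSet.diff {m : ℕ} {E F : Set (ℕ → S)} (hE : InvSet m E) (hF : InvSet m F) :
    InvSet m (E \ F) := hE.inter hF.compl

lemma InvSet.preimage {m : ℕ} {E : Set (ℕ → S)} (hE : InvSet m E) (r : ℕ) :
    InvSet m (pathShift^[r] ⁻¹' E) := by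
  refine ⟨fun ω => ?_, measurable_pathShift_iterate r hE.2⟩
  rw [mem_preimage, mem_preimage, ← Function.iterate_add_apply, add_comm,
    Function.iterate_add_apply]
  exact hE.1 _

lemma InvSet.univ (m : ℕ) : InvSet m (Set.univ : Set (ℕ → S)) :=
  ⟨fun _ => Iff.rfl, MeasurableSet.univ⟩

lemma InvSet.of_dvd {m n : ℕ} (h : m ∣ n) {E : Set (ℕ → S)} (hE : InvSet m E) : InvSet n E := by
  obtain ⟨k, rfl⟩ := h
  refine ⟨fun ω => ?_, hE.2⟩
  rw [mul_comm m k, ← mem_preimage (s := E), hE.preimage_mul]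

lemma InvSet.orbit {m d n : ℕ} (hn : 0 < n) (h : m ∣ n * d) {E : Set (ℕ → S)}
    (hE : InvSet m E) : InvSet d (orbit d n E) := by
  refine ⟨fun ω => ?_, ?_⟩
  · have hEn := hE.of_dvd h
    simp only [mem_orbit, ← Function.iterate_add_apply, ← Nat.succ_mul]
    constructor
    · rintro ⟨_ | r, hr, hω⟩
      · refine ⟨n - 1, by omega, ?_⟩
        rw [Nat.succ_eq_add_one, Nat.sub_add_cancel hn, ← hEn.1 ω]
        simpa using hω
      · exact ⟨r, by omega, hω⟩
    · rintro ⟨r, hr, hω⟩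
      rcases (Nat.succ_le_of_lt hr).lt_or_eq with hlt | heq
      · exact ⟨r + 1, hlt, hω⟩
      · refine ⟨0, hn, ?_⟩
        rw [heq, ← hEn.1 ω] at hω
        simpa using hω
  · exact MeasurableSet.biUnion (Set.to_countable _) fun r _ =>
      measurable_pathShift_iterate _ hE.2

lemma mem_U_iff (X : MarkovChain S) (m : ℕ) (C : Set S) (ω : ℕ → S) :
    ω ∈ X.U m C ↔ ∃ᶠ k in atTop, ω (k * m) ∈ C := frequently_atTop.symm

lemma mem_L_iff (X : MarkovChain S) (m : ℕ) (C : Set S) (ω : ℕ → S) :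
    ω ∈ X.L m C ↔ ∀ᶠ k in atTop, ω (k * m) ∈ C := eventually_atTop.symm

lemma L_subset_U (X : MarkovChain S) (m : ℕ) (C : Set S) : X.L m C ⊆ X.U m C := fun ω hω => by
  rw [mem_U_iff]
  exact ((mem_L_iff X m C ω).1 hω).frequently

lemma U_compl (X : MarkovChain S) (m : ℕ) (C : Set S) : X.U m Cᶜ = (X.L m C)ᶜ := by
  ext ω
  rw [mem_U_iff, mem_compl_iff, mem_L_iff, not_eventually]
  rfl

lemma L_compl (X : MarkovChain S) (m : ℕ) (C : Set S) : X.L m Cᶜ = (X.U m C)ᶜ := by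
  rw [← compl_compl (X.L m Cᶜ), ← U_compl, compl_compl]

lemma L_mono (X : MarkovChain S) (m : ℕ) {C D : Set S} (h : C ⊆ D) : X.L m C ⊆ X.L m D :=
  fun _ ⟨n, hn⟩ => ⟨n, fun k hk => h (hn k hk)⟩

lemma U_mono (X : MarkovChain S) (m : ℕ) {C D : Set S} (h : C ⊆ D) : X.U m C ⊆ X.U m D :=
  fun _ hω n => (hω n).imp fun _ hk => ⟨hk.1, h hk.2⟩

lemma L_inter (X : MarkovChain S) (m : ℕ) (C D : Set S) :
    X.L m (C ∩ D) = X.L m C ∩ X.L m D := by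
  ext ω
  simp only [mem_inter_iff, mem_L_iff, eventually_and]

lemma disjoint_L (X : MarkovChain S) (m : ℕ) {C D : Set S} (h : Disjoint C D) :
    Disjoint (X.L m C) (X.L m D) := by
  rw [Set.disjoint_iff_inter_eq_empty, ← L_inter, h.inter_eq]
  exact eq_empty_of_forall_notMem fun ω ⟨n, hn⟩ => hn n le_rfl

/-- `C` represents the event `E` for the `m`-step chain: up to null events, `E` is the event of
visiting `C` infinitely often and also that of staying in `C` eventually. -/
def Represents (X : MarkovChain S) (m : ℕ) (C : Set S) (E : Set (ℕ → S)) : Prop :=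
  X.L m C =ᵐ[X.μ] E ∧ X.U m C =ᵐ[X.μ] E

lemma Represents.compl {X : MarkovChain S} {m : ℕ} {C : Set S} {E : Set (ℕ → S)}
    (h : X.Represents m C E) : X.Represents m Cᶜ Eᶜ := by
  rw [Represents, L_compl, U_compl]
  exact ⟨h.2.compl, h.1.compl⟩

lemma Represents.inter {X : MarkovChain S} {m : ℕ} {C D : Set S} {E F : Set (ℕ → S)}
    (hC : X.Represents m C E) (hD : X.Represents m D F) : X.Represents m (C ∩ D) (E ∩ F) := by
  have hL : X.L m (C ∩ D) =ᵐ[X.μ] (E ∩ F : Set (ℕ → S)) := by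
    rw [L_inter]
    exact hC.1.inter hD.1
  have hU : X.U m (C ∩ D) ≤ᵐ[X.μ] (E ∩ F : Set (ℕ → S)) :=
    (LE.le.eventuallyLE (subset_inter (U_mono X m inter_subset_left)
      (U_mono X m inter_subset_right))).trans (hC.2.inter hD.2).le
  exact ⟨hL, hU.antisymm (hL.symm.le.trans (L_subset_U X m _).eventuallyLE)⟩

lemma Represents.almostClosed {X : MarkovChain S} {m : ℕ} {C : Set S} {E : Set (ℕ → S)}
    (h : X.Represents m C E) (hE : X.μ E ≠ 0) : X.AlmostClosed m C := by
  refine ⟨measure_symmDiff_eq_zero_iff.2 (h.2.trans h.1.symm), ?_⟩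
  rw [Transient, measure_congr h.2]
  exact hE

lemma AlmostClosed.represents {X : MarkovChain S} {m : ℕ} {C : Set S}
    (h : X.AlmostClosed m C) : X.Represents m C (X.L m C) :=
  ⟨EventuallyEq.rfl, measure_symmDiff_eq_zero_iff.1 h.1⟩

lemma AlmostClosed.measure_L_ne_zero {X : MarkovChain S} {m : ℕ} {C : Set S}
    (h : X.AlmostClosed m C) : X.μ (X.L m C) ≠ 0 := by
  rw [← measure_congr h.represents.2]
  exact h.2

/-- `E` is an atom of the invariant events of the `m`-step chain. -/
def IsAtom (X : MarkovChain S) (m : ℕ) (E : Set (ℕ → S)) : Prop :=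
  InvSet m E ∧ X.μ E ≠ 0 ∧ ∀ F, InvSet m F → X.μ (E ∩ F) = 0 ∨ X.μ (E \ F) = 0

lemma IsAtom.of_diff_null {X : MarkovChain S} {m : ℕ} {E F : Set (ℕ → S)} (hE : X.IsAtom m E)
    (hF : InvSet m F) (h0 : X.μ F ≠ 0) (hd : X.μ (F \ E) = 0) : X.IsAtom m F := by
  refine ⟨hF, h0, fun G hG => (hE.2.2 G hG).imp (fun h => ?_) fun h => ?_⟩
  · refine measure_mono_null (fun ω hω => ?_) (measure_union_null hd h)
    by_cases hωE : ω ∈ E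
    · exact Or.inr ⟨hωE, hω.2⟩
    · exact Or.inl ⟨hω.1, hωE⟩
  · refine measure_mono_null (fun ω hω => ?_) (measure_union_null hd h)
    by_cases hωE : ω ∈ E
    · exact Or.inr ⟨hωE, hω.2⟩
    · exact Or.inl ⟨hω.1, hωE⟩

lemma IsAtom.measure_compl_eq_zero {X : MarkovChain S} {m : ℕ} (h : X.IsAtom m Set.univ)
    {E : Set (ℕ → S)} (hE : InvSet m E) (h0 : X.μ E ≠ 0) : X.μ Eᶜ = 0 := by
  simpa [← compl_eq_univ_sdiff, h0] using h.2.2 E hE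

lemma exists_isBlackwell_of_beta_eq {X : MarkovChain S} {m n : ℕ} (h : X.beta m = n) :
    ∃ 𝒞, X.IsBlackwell m 𝒞 ∧ 𝒞.encard = n := by
  have hne : (Set.encard '' {𝒞 : Set (Set S) | X.IsBlackwell m 𝒞}).Nonempty := by
    by_contra hempty
    rw [beta, not_nonempty_iff_eq_empty.1 hempty, sInf_empty] at h
    exact ENat.top_ne_natCast n h
  obtain ⟨𝒞, h𝒞, hcard⟩ := csInf_mem hne
  exact ⟨𝒞, h𝒞, hcard.trans h⟩

lemma IsBlackwell.beta_eq_one {X : MarkovChain S} {m : ℕ} {C : Set S}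
    (h : X.IsBlackwell m {C}) : X.beta m = 1 := by
  refine le_antisymm (sInf_le ⟨{C}, h, encard_singleton C⟩) (le_sInf ?_)
  rintro _ ⟨𝒞, h𝒞, rfl⟩
  rw [one_le_encard_iff_nonempty]
  by_contra hempty
  have := h𝒞.sum_L_eq_one
  rw [not_nonempty_iff_eq_empty.1 hempty] at this
  simp at this

lemma IsBlackwell.measure_L_eq_one {X : MarkovChain S} {m : ℕ} {C : Set S}
    (h : X.IsBlackwell m {C}) : X.μ (X.L m C) = 1 := by
  rw [← h.sum_L_eq_one, tsum_singleton (f := fun C => X.μ (X.L m C))]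

/-- The number of visits to `E` of the first `m` shifts of a path. -/
noncomputable def visits (m : ℕ) (E : Set (ℕ → S)) (ω : ℕ → S) : ℕ :=
  ∑ r ∈ Finset.range m, E.indicator (fun _ => 1) (pathShift^[r] ω)

lemma InvSet.exists_visits_eq {X : MarkovChain S} (hX : X.IsAtom 1 Set.univ) {m : ℕ}
    {E : Set (ℕ → S)} (hE : InvSet m E) : ∃ j, ∀ᵐ ω ∂X.μ, visits m E ω = j := by
  have hinv (j : ℕ) : InvSet 1 {ω | visits m E ω = j} := by
    constructor
    · intro ω
      have : visits m E (pathShift^[1] ω) = visits m E ω := by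
        simp only [visits, ← Function.iterate_add_apply]
        have h1 := Finset.sum_range_succ
          (fun r => E.indicator (fun _ => 1) (pathShift^[r] ω)) m
        rw [Finset.sum_range_succ'] at h1
        have h2 : E.indicator (fun _ => 1) (pathShift^[m] ω) =
            E.indicator (fun _ => 1) (pathShift^[0] ω) := by
          by_cases h : ω ∈ E
          · rw [indicator_of_mem ((hE.1 ω).1 h), indicator_of_mem (by simpa using h)]
          · rw [indicator_of_notMem (fun h' => h ((hE.1 ω).2 h')),
              indicator_of_notMem (by simpa using h)]
        rw [h2] at h1
        exact Nat.add_right_cancel h1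
      simp only [mem_ofPred_eq, this]
    · refine measurableSet_eq_fun (Finset.measurable_sum _ fun r _ => ?_) measurable_const
      exact (measurable_const.indicator hE.2).comp (measurable_pathShift_iterate r)
  by_contra hcon
  have hnull (j : ℕ) : X.μ {ω | visits m E ω = j} = 0 := by
    by_contra h0
    exact hcon ⟨j, hX.measure_compl_eq_zero (hinv j) h0⟩
  have : X.μ (⋃ j, {ω | visits m E ω = j}) = 0 := measure_iUnion_null hnull
  rw [eq_univ_of_forall (s := ⋃ j, {ω | visits m E ω = j}) fun ω => mem_iUnion.2 ⟨_, rfl⟩] at this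
  exact hX.2.1 this

/-- If the invariant events of the chain are trivial, then those of the `m`-step chain have
an atom. -/
lemma IsAtom.exists_isAtom {X : MarkovChain S} (hX : X.IsAtom 1 Set.univ) {m : ℕ} (hm : 0 < m) :
    ∃ E, X.IsAtom m E := by
  classical
  have hex : ∃ j, ∃ E, InvSet m E ∧ X.μ E ≠ 0 ∧ ∀ᵐ ω ∂X.μ, visits m E ω = j := by
    obtain ⟨j, hj⟩ := (InvSet.univ (S := S) m).exists_visits_eq hX
    exact ⟨j, Set.univ, InvSet.univ m, hX.2.1, hj⟩
  obtain ⟨E, hE, h0, hj⟩ := Nat.find_spec hex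
  refine ⟨E, hE, h0, fun F hF => ?_⟩
  by_contra! hcon
  obtain ⟨j₁, hj₁⟩ := (hE.inter hF).exists_visits_eq hX
  obtain ⟨j₂, hj₂⟩ := (hE.diff hF).exists_visits_eq hX
  have hle₁ := Nat.find_min' hex ⟨_, hE.inter hF, hcon.1, hj₁⟩
  have hle₂ := Nat.find_min' hex ⟨_, hE.diff hF, hcon.2, hj₂⟩
  refine h0 (measure_eq_zero_iff_ae_notMem.2 ?_)
  filter_upwards [hj, hj₁, hj₂] with ω h h₁ h₂ hωE
  have hsum : visits m (E ∩ F) ω + visits m (E \ F) ω = visits m E ω := by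
    rw [visits, visits, visits, ← Finset.sum_add_distrib]
    refine Finset.sum_congr rfl fun r _ => ?_
    by_cases hF' : pathShift^[r] ω ∈ F <;> by_cases hE' : pathShift^[r] ω ∈ E <;>
      simp [indicator, hF', hE']
  have hpos : 1 ≤ visits m E ω := by
    refine le_trans ?_ (Finset.single_le_sum (f := fun r => E.indicator (fun _ => 1)
      (pathShift^[r] ω)) (fun _ _ => Nat.zero_le _) (Finset.mem_range.2 hm))
    simp [hωE]
  omega

lemma Represents.congr {X : MarkovChain S} {m : ℕ} {C : Set S} {E F : Set (ℕ → S)}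
    (h : X.Represents m C E) (hEF : E =ᵐ[X.μ] F) : X.Represents m C F :=
  ⟨h.1.trans hEF, h.2.trans hEF⟩

lemma period_eq_one_iff {X : MarkovChain S} (h : X.beta 1 = 1) :
    X.period = 1 ↔ ∀ m : ℕ, 1 < m → X.beta m ≠ m := by
  rw [period]
  constructor
  · intro hper m hm hβ
    have : (m : ℕ∞) ≤ 1 := hper ▸ le_sSup ⟨m, hm.le, hβ, rfl⟩
    exact absurd (by exact_mod_cast this) (not_le.2 hm)
  · intro hne
    refine le_antisymm (sSup_le ?_) (le_sSup ⟨1, le_rfl, by simpa using h, by simp⟩)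
    rintro _ ⟨m, hm, hβ, rfl⟩
    rw [hm.antisymm' (not_lt.1 fun hlt => hne m hlt hβ), Nat.cast_one]

variable [MeasurableSingletonClass S] [Countable S]

/-- The conditional law of the future given the past depends only on the present state. -/
lemma markov_cyl (X : MarkovChain S) {s t : ℕ → S} {n k : ℕ} (h : s n = t k)
    {E : Set (ℕ → S)} (hE : MeasurableSet E) :
    X.μ (cyl t k) * X.μ (cyl s n ∩ pathShift^[n] ⁻¹' E) =
      X.μ (cyl s n) * X.μ (cyl t k ∩ pathShift^[k] ⁻¹' E) := by
  have key : X.μ (cyl t k) • (X.μ.restrict (cyl s n)).map pathShift^[n] =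
      X.μ (cyl s n) • (X.μ.restrict (cyl t k)).map pathShift^[k] := by
    have apply_eq (r : ℕ → S) (j : ℕ) {F : Set (ℕ → S)} (hF : MeasurableSet F) :
        (X.μ.restrict (cyl r j)).map pathShift^[j] F =
          X.μ (cyl r j ∩ pathShift^[j] ⁻¹' F) := by
      rw [Measure.map_apply (measurable_pathShift_iterate j) hF,
        Measure.restrict_apply (measurable_pathShift_iterate j hF), inter_comm]
    have : IsFiniteMeasure (X.μ (cyl t k) • (X.μ.restrict (cyl s n)).map pathShift^[n]) :=
      Measure.smul_finite _ (measure_ne_top _ _)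
    refine ext_of_generate_finite cylinders generateFrom_cylinders isPiSystem_cylinders ?_ ?_
    · rintro _ (rfl | ⟨u, l, rfl⟩)
      · simp
      · simp only [Measure.smul_apply, smul_eq_mul, apply_eq _ _ (measurableSet_cyl u l)]
        by_cases hu : s n = u 0
        · rw [measure_cyl_inter_preimage_cyl X hu, measure_cyl_inter_preimage_cyl X (h ▸ hu)]
          ring
        · have empty (r : ℕ → S) (j : ℕ) (hr : r j ≠ u 0) :
              cyl r j ∩ pathShift^[j] ⁻¹' cyl u l = ∅ := by
            refine eq_empty_of_forall_notMem fun ω hω => hr ?_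
            have := hω.2 0 (Nat.zero_le _)
            rw [pathShift_iterate_apply, zero_add] at this
            rw [← this, hω.1 j le_rfl]
          rw [empty s n hu, empty t k (h ▸ hu)]
          simp
    · simp only [Measure.smul_apply, smul_eq_mul, apply_eq _ _ MeasurableSet.univ, preimage_univ,
        inter_univ, mul_comm]
  have := congrArg (fun ν : Measure (ℕ → S) => ν E) key
  simpa only [Measure.smul_apply, smul_eq_mul,
    Measure.map_apply (measurable_pathShift_iterate _) hE,
    Measure.restrict_apply (measurable_pathShift_iterate _ hE), inter_comm] using this

/-- For every event `E` there is a function `h` on `S` with `h i` playing the role of the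
probability of `E` for the chain started in `i`. -/
lemma exists_markov_kernel (X : MarkovChain S) {E : Set (ℕ → S)} (hE : MeasurableSet E) :
    ∃ h : S → ENNReal, (∀ i, h i ≤ 1) ∧ ∀ s n,
      X.μ (cyl s n ∩ pathShift^[n] ⁻¹' E) = X.μ (cyl s n) * h (s n) := by
  classical
  have (i : S) : ∃ p : ENNReal, p ≤ 1 ∧ ∀ s n, s n = i →
      X.μ (cyl s n ∩ pathShift^[n] ⁻¹' E) = X.μ (cyl s n) * p := by
    by_cases hi : ∃ t k, t k = i ∧ X.μ (cyl t k) ≠ 0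
    · obtain ⟨t, k, rfl, ht⟩ := hi
      refine ⟨X.μ (cyl t k ∩ pathShift^[k] ⁻¹' E) / X.μ (cyl t k),
        ENNReal.div_le_of_le_mul (by simpa using measure_mono inter_subset_left), ?_⟩
      intro s n hs
      rw [← mul_div_assoc, ← markov_cyl X hs hE,
        mul_comm, ENNReal.mul_div_cancel_right ht (measure_ne_top _ _)]
    · push Not at hi
      refine ⟨0, zero_le_one, fun s n hs => ?_⟩
      rw [mul_zero]
      exact measure_mono_null inter_subset_left (hi s n hs)
  choose h h1 h2 using this
  exact ⟨h, h1, fun s n => h2 _ s n rfl⟩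

lemma measure_inter_preimage_eq_setLIntegral (X : MarkovChain S) {E : Set (ℕ → S)}
    {h : S → ENNReal}
    (hh : ∀ s n, X.μ (cyl s n ∩ pathShift^[n] ⁻¹' E) = X.μ (cyl s n) * h (s n))
    (hE : MeasurableSet E) {n : ℕ} {A : Set (ℕ → S)} (hA : Determined n A) :
    X.μ (A ∩ pathShift^[n] ⁻¹' E) = ∫⁻ ω in A, h (ω n) ∂X.μ := by
  have hcount : ((fun s : ℕ → S => cyl s n) '' A).Countable :=
    (countable_range_cyl n).mono (Set.image_subset_range _ _)
  have hmeas : ∀ c ∈ (fun s : ℕ → S => cyl s n) '' A, MeasurableSet c := by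
    rintro _ ⟨s, -, rfl⟩
    exact measurableSet_cyl s n
  conv_lhs => rw [hA.eq_biUnion]
  conv_rhs => rw [hA.eq_biUnion]
  rw [iUnion₂_inter, measure_biUnion hcount, lintegral_biUnion hcount hmeas
    (pairwiseDisjoint_cyl n A)]
  · refine tsum_congr ?_
    rintro ⟨_, s, -, rfl⟩
    have : ∫⁻ ω in cyl s n, h (ω n) ∂X.μ = ∫⁻ _ in cyl s n, h (s n) ∂X.μ :=
      setLIntegral_congr_fun (measurableSet_cyl s n) fun ω hω => by
        simp only [hω n le_rfl]
    simp only [this, hh, setLIntegral_const, mul_comm]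
  · exact (pairwiseDisjoint_cyl n A).mono fun c => inter_subset_left
  · exact fun c hc => (hmeas c hc).inter (measurable_pathShift_iterate n hE)

/-- Lévy's zero-one law for events that are invariant under the `m`-step shift. -/
lemma tendsto_of_invariant (X : MarkovChain S) {m : ℕ} (hm : 0 < m) {E : Set (ℕ → S)}
    {h : S → ENNReal} (h_le : ∀ i, h i ≤ 1)
    (hh : ∀ s n, X.μ (cyl s n ∩ pathShift^[n] ⁻¹' E) = X.μ (cyl s n) * h (s n))
    (hE : MeasurableSet E) (hinv : ∀ k, pathShift^[k * m] ⁻¹' E = E) :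
    ∀ᵐ ω ∂X.μ, Tendsto (fun k => (h (ω (k * m))).toReal) atTop
      (nhds (E.indicator (fun _ => (1 : ℝ)) ω)) := by
  let ℱ : Filtration ℕ (MeasurableSpace.pi : MeasurableSpace (ℕ → S)) := Filtration.piLE
  have hdet {n : ℕ} {A : Set (ℕ → S)} (hA : MeasurableSet[ℱ n] A) : Determined n A := by
    obtain ⟨B, -, rfl⟩ := hA
    intro ω hω η hη
    have : Preorder.restrictLe n η = Preorder.restrictLe (π := fun _ => S) n ω :=
      funext fun k => hη k k.2
    rw [mem_preimage, this]
    exact hω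
  have hcyl (s : ℕ → S) (n : ℕ) : MeasurableSet[ℱ n] (cyl s n) := by
    refine ⟨{Preorder.restrictLe n s}, measurableSet_singleton _, ?_⟩
    ext ω
    simp only [mem_preimage, mem_singleton_iff, funext_iff, cyl, mem_ofPred_eq]
    exact ⟨fun H k hk => H ⟨k, hk⟩, fun H k => H k k.2⟩
  have hsup : ⨆ n, ℱ n = (MeasurableSpace.pi : MeasurableSpace (ℕ → S)) := by
    refine le_antisymm (iSup_le fun n => ℱ.le n) ?_
    refine generateFrom_cylinders.le.trans (MeasurableSpace.generateFrom_le ?_)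
    rintro _ (rfl | ⟨s, n, rfl⟩)
    · exact MeasurableSpace.measurableSet_empty _
    · exact le_iSup (fun n => (ℱ n : MeasurableSpace (ℕ → S))) n _ (hcyl s n)
  have hint : Integrable (E.indicator fun _ => (1 : ℝ)) X.μ :=
    (integrable_const 1).indicator hE
  have hmeas (n : ℕ) : Measurable fun ω : ℕ → S => h (ω n) :=
    (measurable_of_countable h).comp (measurable_pi_apply n)
  have hbound (n : ℕ) (ω : ℕ → S) : (h (ω n)).toReal ≤ 1 :=
    ENNReal.toReal_le_of_le_ofReal zero_le_one (by simpa using h_le _)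
  have hgint (n : ℕ) : Integrable (fun ω => (h (ω n)).toReal) X.μ :=
    Integrable.of_bound (hmeas n).ennreal_toReal.aestronglyMeasurable 1
      (ae_of_all _ fun ω => by
        rw [Real.norm_of_nonneg ENNReal.toReal_nonneg]; exact hbound n ω)
  have hcond (k : ℕ) : (fun ω => (h (ω (k * m))).toReal) =ᵐ[X.μ]
      X.μ[E.indicator fun _ => (1 : ℝ) | ℱ (k * m)] := by
    refine ae_eq_condExp_of_forall_setIntegral_eq (ℱ.le _) hint
      (fun A _ _ => (hgint _).integrableOn) ?_ ?_
    · intro A hA _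
      rw [integral_toReal (hmeas _).aemeasurable
        (ae_of_all _ fun ω => (h_le _).trans_lt ENNReal.one_lt_top),
        ← measure_inter_preimage_eq_setLIntegral X hh hE (hdet hA), hinv k,
        setIntegral_indicator hE, setIntegral_const]
      simp [Measure.real]
    · refine StronglyMeasurable.aestronglyMeasurable (Measurable.stronglyMeasurable ?_)
      intro B _
      refine Determined.measurableSet_of_cylinders (fun s => hcyl s (k * m)) ?_
      intro ω hω η hη
      simpa only [mem_preimage, hη _ le_rfl] using hω
  have hsm : StronglyMeasurable (E.indicator fun _ => (1 : ℝ)) :=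
    (measurable_const.indicator hE).stronglyMeasurable
  have hlevy := hint.tendsto_ae_condExp (ℱ := ℱ) (hsm.mono hsup.ge)
  filter_upwards [hlevy, ae_all_iff.2 hcond] with ω h1 h2
  have h3 := h1.comp (tendsto_atTop_mono (fun k => Nat.le_mul_of_pos_right k hm) tendsto_id)
  exact h3.congr fun k => (h2 k).symm

/-- If an invariant event of the `m`-step chain is null, then so are its shifts. -/
lemma measure_preimage_eq_zero (X : MarkovChain S) (hirr : X.Irreducible) (hap : X.Aperiodic)
    {m : ℕ} (hm : 0 < m) {E : Set (ℕ → S)} (hE : MeasurableSet E)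
    (hinv : ∀ k, pathShift^[k * m] ⁻¹' E = E) (h0 : X.μ E = 0) (r : ℕ) :
    X.μ (pathShift^[r] ⁻¹' E) = 0 := by
  obtain ⟨h, -, hh⟩ := exists_markov_kernel X hE
  obtain ⟨j, hj⟩ : ∃ j, 0 < X.init j := by
    by_contra! hcon
    have := (hasSum_zero (α := ℝ) (β := S)).unique
      (by simpa [funext fun i => le_antisymm (hcon i) (X.init_nonneg i)] using X.init_hasSum)
    exact zero_ne_one this
  have hzero (i : S) : h i = 0 := by
    obtain ⟨k, s, rfl, rfl, hs⟩ := exists_reach_mul X hirr hap hm j i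
    have hpos : X.μ (cyl s (k * m)) ≠ 0 := by
      rw [measure_cyl, Ne, ENNReal.ofReal_eq_zero, not_le]
      exact mul_pos hj (Finset.prod_pos fun l hl => hs l (Finset.mem_range.1 hl))
    have := hh s (k * m)
    rw [hinv k, measure_mono_null inter_subset_right h0] at this
    exact (mul_eq_zero.1 this.symm).resolve_left hpos
  have := measure_inter_preimage_eq_setLIntegral X hh hE (n := r) (A := univ)
    fun _ _ => subset_univ _
  simpa [hzero] using this

lemma invSet_L (X : MarkovChain S) (m : ℕ) (C : Set S) : InvSet m (X.L m C) := by
  constructor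
  · intro ω
    simp only [mem_L_iff, pathShift_iterate_apply, ← Nat.succ_mul]
    conv_lhs => rw [← map_add_atTop_eq_nat 1]
    exact Iff.rfl
  · have : X.L m C = ⋃ n, ⋂ k ∈ Ici n, (fun ω : ℕ → S => ω (k * m)) ⁻¹' C := by
      ext ω
      simp [L]
    rw [this]
    exact MeasurableSet.iUnion fun n => MeasurableSet.biInter (Set.to_countable _) fun k _ =>
      measurable_pi_apply _ C.to_countable.measurableSet

/-- Blackwell's correspondence: every invariant event of the `m`-step chain is represented by a
set of states. -/
lemma InvSet.exists_represents (X : MarkovChain S) {m : ℕ} (hm : 0 < m) {E : Set (ℕ → S)}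
    (hE : InvSet m E) : ∃ C, X.Represents m C E := by
  obtain ⟨h, h_le, hh⟩ := exists_markov_kernel X hE.2
  let C : Set S := {i | 1 / 2 < (h i).toReal}
  have hlim := tendsto_of_invariant X hm h_le hh hE.2 hE.preimage_mul
  have h1 : E ≤ᵐ[X.μ] X.L m C := by
    filter_upwards [hlim] with ω hω hωE
    refine (mem_L_iff X m C ω).2 (hω.eventually_const_lt ?_)
    rw [indicator_of_mem hωE]
    norm_num
  have h2 : X.U m C ≤ᵐ[X.μ] E := by
    filter_upwards [hlim] with ω hω hωU
    by_contra hωE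
    change ω ∉ E at hωE
    refine (mem_U_iff X m C ω).1 hωU ?_
    have : E.indicator (fun _ => (1 : ℝ)) ω < 1 / 2 := by
      rw [indicator_of_notMem hωE]
      norm_num
    filter_upwards [hω.eventually_lt_const this] with k hk hkC
    exact lt_asymm hk hkC
  have h3 := (L_subset_U X m C).eventuallyLE (l := ae X.μ)
  exact ⟨C, (h3.trans h2).antisymm h1, h2.antisymm (h1.trans h3)⟩

lemma IsAtom.atomic {X : MarkovChain S} {m : ℕ} {C : Set S} {E : Set (ℕ → S)}
    (hE : X.IsAtom m E) (hC : X.Represents m C E) : X.Atomic m C := by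
  refine ⟨hC.almostClosed hE.2.1, ?_⟩
  rintro ⟨A, B, hA, hB, hAB, hA', hB'⟩
  have hsub {D : Set S} (hD : D ⊆ C) : X.μ (X.L m D \ E) = 0 :=
    measure_mono_null (sdiff_subset_sdiff_left (L_mono X m hD)) (ae_le_set.1 hC.1.le)
  rcases hE.2.2 _ (invSet_L X m A) with h | h
  · refine hA'.measure_L_ne_zero (measure_mono_null (fun ω hω => ?_)
      (measure_union_null (hsub hA) h))
    by_cases hωE : ω ∈ E
    · exact Or.inr ⟨hωE, hω⟩
    · exact Or.inl ⟨hω, hωE⟩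
  · refine hB'.measure_L_ne_zero (measure_mono_null (fun ω hω => ?_)
      (measure_union_null (hsub hB) h))
    by_cases hωE : ω ∈ E
    · exact Or.inr ⟨hωE, Set.disjoint_right.1 (disjoint_L X m hAB) hω⟩
    · exact Or.inl ⟨hω, hωE⟩

lemma Atomic.isAtom {X : MarkovChain S} {m : ℕ} (hm : 0 < m) {C : Set S}
    (hC : X.Atomic m C) : X.IsAtom m (X.L m C) := by
  refine ⟨invSet_L X m C, hC.1.measure_L_ne_zero, fun F hF => ?_⟩
  by_contra! hcon
  obtain ⟨D, hD⟩ := hF.exists_represents X hm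
  exact hC.2 ⟨C ∩ D, C ∩ Dᶜ, inter_subset_left, inter_subset_left,
    (disjoint_compl_right (a := D)).mono inter_subset_right inter_subset_right,
    (hC.1.represents.inter hD).almostClosed hcon.1,
    (hC.1.represents.inter hD.compl).almostClosed hcon.2⟩

/-- An almost closed set which meets an atom contains an atomic set representing the
intersection. -/
lemma IsAtom.exists_atomic_subset {X : MarkovChain S} {m : ℕ} (hm : 0 < m) {C : Set S}
    {E : Set (ℕ → S)} (hE : X.IsAtom m E) (hC : X.AlmostClosed m C)
    (h : X.μ (E ∩ X.L m C) ≠ 0) :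
    ∃ A ⊆ C, X.Atomic m A ∧ X.Represents m A (E ∩ X.L m C) := by
  obtain ⟨D, hD⟩ := hE.1.exists_represents X hm
  have hrep := hD.inter hC.represents
  have hatom : X.IsAtom m (E ∩ X.L m C) :=
    hE.of_diff_null (hE.1.inter (invSet_L X m C)) h
      (by rw [Set.sdiff_eq_empty.2 inter_subset_left, measure_empty])
  exact ⟨D ∩ C, inter_subset_right, hatom.atomic hrep, hrep⟩

lemma InvSet.measure_preimage_eq_zero {X : MarkovChain S} (hirr : X.Irreducible)
    (hap : X.Aperiodic) {m : ℕ} (hm : 0 < m) {E : Set (ℕ → S)} (hE : InvSet m E)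
    (h0 : X.μ E = 0) (r : ℕ) : X.μ (pathShift^[r] ⁻¹' E) = 0 :=
  MarkovChain.measure_preimage_eq_zero X hirr hap hm hE.2 hE.preimage_mul h0 r

lemma IsAtom.preimage {X : MarkovChain S} (hirr : X.Irreducible) (hap : X.Aperiodic) {m : ℕ}
    (hm : 0 < m) {E : Set (ℕ → S)} (hE : X.IsAtom m E) (r : ℕ) :
    X.IsAtom m (pathShift^[r] ⁻¹' E) := by
  have hr : r * (m - 1) + r = r * m := by
    rw [← Nat.mul_succ, Nat.succ_eq_add_one, Nat.sub_add_cancel hm]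
  have h1 (F : Set (ℕ → S)) (hF : InvSet m F) :
      pathShift^[r * (m - 1)] ⁻¹' (pathShift^[r] ⁻¹' F) = F := by
    rw [← preimage_comp, ← Function.iterate_add, add_comm, hr, hF.preimage_mul]
  have h2 (F : Set (ℕ → S)) (hF : InvSet m F) :
      pathShift^[r] ⁻¹' (pathShift^[r * (m - 1)] ⁻¹' F) = F := by
    rw [← preimage_comp, ← Function.iterate_add, hr, hF.preimage_mul]
  refine ⟨hE.1.preimage r, fun h0 => hE.2.1 ?_, fun F hF => ?_⟩
  · rw [← h1 E hE.1]
    exact (hE.1.preimage r).measure_preimage_eq_zero hirr hap hm h0 _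
  · have hF' := hF.preimage (r * (m - 1))
    rw [← h2 F hF, ← preimage_inter, ← preimage_sdiff]
    exact (hE.2.2 _ hF').imp
      (fun h => (hE.1.inter hF').measure_preimage_eq_zero hirr hap hm h r)
      fun h => (hE.1.diff hF').measure_preimage_eq_zero hirr hap hm h r

/-- The orbit of an atom of the invariant events of the `m`-step chain is an atom of the invariant
events of the chain itself. -/
lemma IsAtom.orbit {X : MarkovChain S} (hirr : X.Irreducible) (hap : X.Aperiodic) {m : ℕ}
    (hm : 0 < m) {E : Set (ℕ → S)} (hE : X.IsAtom m E) : X.IsAtom 1 (orbit 1 m E) := by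
  refine ⟨hE.1.orbit hm (by simp), fun h => hE.2.1 (measure_mono_null (subset_orbit hm E) h),
    fun F hF => ?_⟩
  have hFm : InvSet m F := hF.of_dvd (one_dvd m)
  refine (hE.2.2 F hFm).imp (fun h => ?_) fun h => ?_
  · refine measure_mono_null (t := ⋃ r : ℕ, pathShift^[r] ⁻¹' (E ∩ F)) (fun ω hω => ?_)
      (measure_iUnion_null fun r => (hE.1.inter hFm).measure_preimage_eq_zero hirr hap hm h r)
    obtain ⟨r, -, hr⟩ := mem_orbit.1 hω.1
    refine mem_iUnion.2 ⟨r * 1, hr, ?_⟩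
    rw [← mem_preimage, hF.preimage_mul]
    exact hω.2
  · refine measure_mono_null (t := ⋃ r : ℕ, pathShift^[r] ⁻¹' (E \ F)) (fun ω hω => ?_)
      (measure_iUnion_null fun r => (hE.1.diff hFm).measure_preimage_eq_zero hirr hap hm h r)
    obtain ⟨r, -, hr⟩ := mem_orbit.1 hω.1
    refine mem_iUnion.2 ⟨r * 1, hr, fun hF' => hω.2 ?_⟩
    rw [← mem_preimage, hF.preimage_mul] at hF'
    exact hF'

lemma Represents.univ (X : MarkovChain S) (m : ℕ) {C : Set S} (h : X.μ (X.L m C) = 1) :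
    X.Represents m C Set.univ := by
  have hL : X.L m C =ᵐ[X.μ] (Set.univ : Set (ℕ → S)) := by
    rw [ae_eq_univ, prob_compl_eq_zero_iff (invSet_L X m C).2]
    exact h
  refine ⟨hL, ?_⟩
  rw [ae_eq_univ] at hL ⊢
  exact measure_mono_null (compl_subset_compl.2 (L_subset_U X m C)) hL

lemma IsAtom.isBlackwell_univ {X : MarkovChain S} {m : ℕ} (h : X.IsAtom m Set.univ) :
    X.IsBlackwell m {Set.univ} := by
  have hL : X.μ (X.L m Set.univ) = 1 := by
    rw [show X.L m Set.univ = Set.univ from eq_univ_of_forall fun ω => ⟨0, by simp⟩]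
    exact measure_univ
  have hat := h.atomic (Represents.univ X m hL)
  exact
    { countable := countable_singleton _
      almostClosed := by rintro C rfl; exact hat.1
      disjoint := pairwiseDisjoint_singleton _ _
      atMostOneNonatomic := by rintro C rfl D rfl - -; rfl
      nonatomicNoAtomicSubset := by rintro C rfl hC; exact absurd hat hC
      nonatomicTransientStates := by rintro C rfl hC; exact absurd hat hC
      sum_L_eq_one := by rw [tsum_singleton (f := fun C => X.μ (X.L m C)), hL] }

/-- A simple chain either has trivial invariant events or has no atoms, and in the latter case the
almost closed set in the decomposition consists of transient states. -/
lemma IsBlackwell.isAtom_univ_or {X : MarkovChain S} {m : ℕ} (hm : 0 < m) {C : Set S}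
    (h : X.IsBlackwell m {C}) :
    X.IsAtom m Set.univ ∨ (∀ E, ¬ X.IsAtom m E) ∧ ∀ i ∈ C, X.Transient m {i} := by
  have hL := h.measure_L_eq_one
  have hLc : X.μ (X.L m C)ᶜ = 0 := (prob_compl_eq_zero_iff (invSet_L X m C).2).2 hL
  by_cases hC : X.Atomic m C
  · refine Or.inl ((hC.isAtom hm).of_diff_null (InvSet.univ m) (by simp) ?_)
    rwa [← compl_eq_univ_sdiff]
  · refine Or.inr ⟨fun E hE => ?_, h.nonatomicTransientStates C rfl hC⟩
    have h0 : X.μ (E ∩ X.L m C) ≠ 0 := by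
      rw [measure_inter_conull hLc]
      exact hE.2.1
    obtain ⟨A, hA, hA', -⟩ := hE.exists_atomic_subset hm (h.almostClosed C rfl) h0
    exact h.nonatomicNoAtomicSubset C rfl hC A hA hA'

/-- If the invariant events of a simple chain have no atom, then all its `m`-step chains are
simple. -/
lemma IsBlackwell.beta_eq_one_of_forall_not_isAtom {X : MarkovChain S} (hirr : X.Irreducible)
    (hap : X.Aperiodic) {C : Set S} (h : X.IsBlackwell 1 {C}) (hX : ∀ E, ¬ X.IsAtom 1 E)
    (htr : ∀ i ∈ C, X.Transient 1 {i}) {m : ℕ} (hm : 0 < m) : X.beta m = 1 := by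
  have hnot (D : Set S) : ¬ X.Atomic m D := fun hD => hX _ ((hD.isAtom hm).orbit hirr hap hm)
  have hsub : X.L 1 C ⊆ X.L m C := fun ω ⟨n, hn⟩ =>
    ⟨n, fun k hk => by simpa using hn (k * m) (hk.trans (Nat.le_mul_of_pos_right k hm))⟩
  have hL : X.μ (X.L m C) = 1 :=
    le_antisymm prob_le_one (h.measure_L_eq_one ▸ measure_mono hsub)
  refine IsBlackwell.beta_eq_one (C := C)
    { countable := countable_singleton _
      almostClosed := ?_
      disjoint := pairwiseDisjoint_singleton _ _
      atMostOneNonatomic := by rintro C rfl D rfl - -; rfl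
      nonatomicNoAtomicSubset := fun _ _ _ A _ => hnot A
      nonatomicTransientStates := ?_
      sum_L_eq_one := by rw [tsum_singleton (f := fun C => X.μ (X.L m C)), hL] }
  · rintro D rfl
    exact (Represents.univ X m hL).almostClosed (by simp)
  · rintro D rfl - i hi
    refine measure_mono_null (t := X.U 1 {i}) (fun ω hω n => ?_) (htr i hi)
    obtain ⟨k, hk, hki⟩ := hω n
    exact ⟨k * m, hk.trans (Nat.le_mul_of_pos_right k hm), by simpa using hki⟩

lemma IsBlackwell.measure_compl_biUnion {X : MarkovChain S} {m : ℕ} {𝒞 : Set (Set S)}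
    (h : X.IsBlackwell m 𝒞) : X.μ (⋃ C ∈ 𝒞, X.L m C)ᶜ = 0 := by
  rw [prob_compl_eq_zero_iff (MeasurableSet.biUnion h.countable fun C _ => (invSet_L X m C).2),
    measure_biUnion (f := X.L m) h.countable
      (fun C hC D hD hCD => disjoint_L X m (h.disjoint hC hD hCD))
      fun C _ => (invSet_L X m C).2]
  exact h.sum_L_eq_one

/-- Two atoms which meet the same member of a Blackwell decomposition meet each other. -/
lemma IsBlackwell.measure_inter_ne_zero {X : MarkovChain S} {m : ℕ} (hm : 0 < m)
    {𝒞 : Set (Set S)} (h : X.IsBlackwell m 𝒞) {C : Set S} (hC : C ∈ 𝒞) {E F : Set (ℕ → S)}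
    (hE : X.IsAtom m E) (hF : X.IsAtom m F) (hEC : X.μ (E ∩ X.L m C) ≠ 0)
    (hFC : X.μ (F ∩ X.L m C) ≠ 0) : X.μ (E ∩ F) ≠ 0 := by
  have hat : X.Atomic m C := by
    by_contra hnot
    obtain ⟨A, hA, hA', -⟩ := hE.exists_atomic_subset hm (h.almostClosed C hC) hEC
    exact h.nonatomicNoAtomicSubset C hC hnot A hA hA'
  have hL := hat.isAtom hm
  rw [inter_comm] at hEC hFC
  have hE' := (hL.2.2 E hE.1).resolve_left hEC
  have hF' := (hL.2.2 F hF.1).resolve_left hFC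
  refine fun h0 => hL.2.1 (measure_mono_null (fun ω hω => ?_)
    (measure_union_null (measure_union_null hE' hF') h0))
  by_cases h1 : ω ∈ E
  · by_cases h2 : ω ∈ F
    · exact Or.inr ⟨h1, h2⟩
    · exact Or.inl (Or.inr ⟨hω, h2⟩)
  · exact Or.inl (Or.inl ⟨hω, h1⟩)

lemma IsBlackwell.le_encard {X : MarkovChain S} {m : ℕ} (hm : 0 < m) {𝒞 : Set (Set S)}
    (h : X.IsBlackwell m 𝒞) {n : ℕ} {E : ℕ → Set (ℕ → S)} (hE : ∀ r, X.IsAtom m (E r))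
    (hdisj : ∀ r < n, ∀ s < n, r ≠ s → X.μ (E r ∩ E s) = 0) : (n : ℕ∞) ≤ 𝒞.encard := by
  have hmeet (r : ℕ) : ∃ C ∈ 𝒞, X.μ (E r ∩ X.L m C) ≠ 0 := by
    by_contra! hcon
    refine (hE r).2.1 ?_
    rw [← measure_inter_conull h.measure_compl_biUnion, inter_iUnion₂]
    exact (measure_biUnion_null_iff h.countable).2 hcon
  choose f hf hf' using hmeet
  have hinj : InjOn f (Finset.range n : Set ℕ) := by
    intro r hr s hs hrs
    by_contra hne
    refine h.measure_inter_ne_zero hm (hf r) (hE r) (hE s) (hf' r) (hrs ▸ hf' s)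
      (hdisj r (by simpa using hr) s (by simpa using hs) hne)
  calc (n : ℕ∞) = (Finset.range n : Set ℕ).encard := by
        rw [encard_coe_eq_coe_finsetCard, Finset.card_range]
    _ = (f '' (Finset.range n : Set ℕ)).encard := hinj.encard_image.symm
    _ ≤ 𝒞.encard := encard_le_encard (image_subset_iff.2 fun r _ => hf r)

/-- Almost disjoint events are represented by disjoint sets. -/
lemma exists_represents_disjoint {X : MarkovChain S} {m : ℕ} (hm : 0 < m) {n : ℕ}
    {E : ℕ → Set (ℕ → S)} (hE : ∀ r, InvSet m (E r))
    (hdisj : ∀ r < n, ∀ s < n, r ≠ s → X.μ (E r ∩ E s) = 0) :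
    ∃ D : ℕ → Set S, Pairwise (Function.onFun Disjoint D) ∧
      ∀ r < n, X.Represents m (D r) (E r) := by
  choose C hC using fun r => (hE r).exists_represents X hm
  refine ⟨disjointed C, disjoint_disjointed C, fun r hr => ?_⟩
  rw [disjointed_eq_inter_compl]
  have key (k : ℕ) (hk : k ≤ r) : X.Represents m (C r ∩ ⋂ i < k, (C i)ᶜ) (E r) := by
    induction k with
    | zero => simpa using hC r
    | succ k ih =>
      rw [biInter_lt_succ, ← inter_assoc]
      refine ((ih (by omega)).inter (hC k).compl).congr ?_
      rw [← sdiff_eq]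
      exact sdiff_ae_eq_self.2 (hdisj r hr k (by omega) (by omega))
  exact key r le_rfl

lemma beta_eq_of_isAtom {X : MarkovChain S} {m : ℕ} (hm : 0 < m) {n : ℕ}
    {E : ℕ → Set (ℕ → S)} (hE : ∀ r, X.IsAtom m (E r))
    (hdisj : ∀ r < n, ∀ s < n, r ≠ s → X.μ (E r ∩ E s) = 0)
    (hcov : X.μ (⋃ r < n, E r) = 1) : X.beta m = n := by
  obtain ⟨D, hD, hrep⟩ := exists_represents_disjoint hm (fun r => (hE r).1) hdisj
  have hat (r : ℕ) (hr : r < n) : X.Atomic m (D r) := (hE r).atomic (hrep r hr)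
  have hinj : InjOn D (Finset.range n : Set ℕ) := by
    intro r hr s hs hrs
    by_contra hne
    have hrs' : Disjoint (D r) (D s) := hD hne
    rw [← hrs] at hrs'
    have h0 : X.L m (D r) = ∅ := disjoint_self.1 (disjoint_L X m hrs')
    exact (hat r (by simpa using hr)).1.measure_L_ne_zero (by simp [h0])
  have hcard : (D '' (Finset.range n : Set ℕ)).encard = n := by
    rw [hinj.encard_image, encard_coe_eq_coe_finsetCard, Finset.card_range]
  refine le_antisymm (sInf_le ⟨D '' (Finset.range n : Set ℕ), ?_, hcard⟩) (le_sInf ?_)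
  · have hat' : ∀ C ∈ D '' (Finset.range n : Set ℕ), X.Atomic m C := by
      rintro _ ⟨r, hr, rfl⟩
      exact hat r (by simpa using hr)
    exact
      { countable := (Finset.countable_toSet _).image _
        almostClosed := fun C hC => (hat' C hC).1
        disjoint := by
          rintro _ ⟨r, -, rfl⟩ _ ⟨s, -, rfl⟩ hrs
          exact hD fun h => hrs (congrArg D h)
        atMostOneNonatomic := fun C hC _ _ hC' => absurd (hat' C hC) hC'
        nonatomicNoAtomicSubset := fun C hC hC' => absurd (hat' C hC) hC'
        nonatomicTransientStates := fun C hC hC' => absurd (hat' C hC) hC'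
        sum_L_eq_one := by
          rw [tsum_image (fun C => X.μ (X.L m C)) hinj,
            Finset.tsum_subtype' (Finset.range n) fun r => X.μ (X.L m (D r)),
            Finset.sum_congr rfl fun r hr =>
              measure_congr (hrep r (Finset.mem_range.1 hr)).1,
            ← measure_biUnion_finset₀ (fun r hr s hs hrs => hdisj r (by simpa using hr) s
              (by simpa using hs) hrs) fun r _ => (hE r).1.2.nullMeasurableSet]
          simpa using hcov }
  · rintro _ ⟨𝒞, h𝒞, rfl⟩
    exact h𝒞.le_encard hm hE hdisj

/-- An atom of the `m`-step chain is almost disjoint from its shifts, if all `d`-step chains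
with `d < m` have trivial invariant events but the `m`-step chain does not. -/
lemma IsAtom.measure_inter_preimage_eq_zero {X : MarkovChain S} (hirr : X.Irreducible)
    (hap : X.Aperiodic) {m : ℕ} (hm : 0 < m) {E : Set (ℕ → S)} (hE : X.IsAtom m E)
    (hnot : ¬ X.IsAtom m Set.univ) {d : ℕ} (hd : X.IsAtom d Set.univ) :
    X.μ (E ∩ pathShift^[d] ⁻¹' E) = 0 := by
  by_contra h
  have hdiff : X.μ (pathShift^[d] ⁻¹' E \ E) = 0 :=
    ((hE.preimage hirr hap hm d).2.2 E hE.1).resolve_left (by rwa [inter_comm])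
  have hk (k : ℕ) : X.μ (pathShift^[k * d] ⁻¹' E \ E) = 0 := by
    induction k with
    | zero => simp
    | succ k ih =>
      refine measure_mono_null (fun ω hω => ?_) (measure_union_null hdiff
        (((hE.1.preimage (k * d)).diff hE.1).measure_preimage_eq_zero hirr hap hm ih d))
      rw [Nat.succ_mul, Function.iterate_add, preimage_comp] at hω
      by_cases h1 : ω ∈ pathShift^[d] ⁻¹' E
      · exact Or.inl ⟨h1, hω.2⟩
      · exact Or.inr ⟨hω.1, h1⟩
  have horb : X.μ (MarkovChain.orbit d m E)ᶜ = 0 :=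
    hd.measure_compl_eq_zero (hE.1.orbit hm (dvd_mul_right m d))
      fun h0 => hE.2.1 (measure_mono_null (subset_orbit hm E) h0)
  refine hnot (hE.of_diff_null (InvSet.univ m) (by simp) ?_)
  refine measure_mono_null (fun ω hω => ?_)
    (measure_union_null horb (measure_iUnion_null hk))
  by_cases h1 : ω ∈ MarkovChain.orbit d m E
  · obtain ⟨r, -, hr⟩ := mem_orbit.1 h1
    exact Or.inr (mem_iUnion.2 ⟨r, hr, hω.2⟩)
  · exact Or.inl h1

lemma beta_eq_self {X : MarkovChain S} (hirr : X.Irreducible) (hap : X.Aperiodic) {m : ℕ}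
    (hm : 1 < m) (hnot : ¬ X.IsAtom m Set.univ)
    (hlt : ∀ d, 0 < d → d < m → X.IsAtom d Set.univ) : X.beta m = m := by
  have hm0 : 0 < m := by omega
  have h1 := hlt 1 one_pos hm
  obtain ⟨E, hE⟩ := h1.exists_isAtom hm0
  have hdisj (r s : ℕ) (hrs : r < s) (hs : s < m) :
      X.μ (pathShift^[r] ⁻¹' E ∩ pathShift^[s] ⁻¹' E) = 0 := by
    obtain ⟨d, rfl⟩ := Nat.exists_eq_add_of_lt hrs
    have hd := hE.measure_inter_preimage_eq_zero hirr hap hm0 hnot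
      (hlt (d + 1) (by omega) (by omega))
    rw [show r + d + 1 = d + 1 + r by ring, Function.iterate_add, preimage_comp, ← preimage_inter]
    exact (hE.1.inter (hE.1.preimage (d + 1))).measure_preimage_eq_zero hirr hap hm0 hd r
  refine beta_eq_of_isAtom hm0 (E := fun r => pathShift^[r] ⁻¹' E)
    (fun r => hE.preimage hirr hap hm0 r) (fun r hr s hs hrs => ?_) ?_
  · rcases hrs.lt_or_gt with h | h
    · exact hdisj r s h hs
    · rw [inter_comm]
      exact hdisj s r h hr
  · have horb := hE.1.orbit hm0 (d := 1) (by simp)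
    have := (prob_compl_eq_zero_iff horb.2).1 (h1.measure_compl_eq_zero horb
      fun h0 => hE.2.1 (measure_mono_null (subset_orbit hm0 E) h0))
    simpa [MarkovChain.orbit] using this

/-- If the invariant events of the `p`-step chain are trivial, then a Blackwell decomposition of
the `q * p`-step chain has at most `q` members. -/
lemma IsBlackwell.encard_le {X : MarkovChain S} {p q : ℕ} (hq : 0 < q)
    (hp : X.IsAtom p Set.univ) {𝒞 : Set (Set S)} (h : X.IsBlackwell (q * p) 𝒞) :
    𝒞.encard ≤ q := by
  have hae : ∀ᵐ ω ∂X.μ, ∀ C ∈ 𝒞, ω ∈ orbit p q (X.L (q * p) C) := by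
    refine (ae_ball_iff h.countable).2 fun C hC => ?_
    exact hp.measure_compl_eq_zero ((invSet_L X (q * p) C).orbit hq dvd_rfl) fun h0 =>
      (h.almostClosed C hC).measure_L_ne_zero (measure_mono_null (subset_orbit hq _) h0)
  obtain ⟨ω, hω⟩ := hae.exists
  have hex (C : 𝒞) : ∃ r < q, pathShift^[r * p] ω ∈ X.L (q * p) C := mem_orbit.1 (hω C C.2)
  choose f hf hf' using hex
  have hinj : Function.Injective f := by
    intro C D hCD
    by_contra hne
    exact Set.disjoint_left.1 (disjoint_L X (q * p) (h.disjoint C.2 D.2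
      fun h' => hne (Subtype.ext h'))) (hf' C) (hCD ▸ hf' D)
  calc 𝒞.encard = (range f).encard := by
        rw [← image_univ, hinj.encard_image, encard_univ, encard]
    _ ≤ (Finset.range q : Set ℕ).encard :=
        encard_le_encard (range_subset_iff.2 fun C => by simpa using hf C)
    _ = q := by rw [encard_coe_eq_coe_finsetCard, Finset.card_range]

lemma IsAtom.isAtom_univ_of_beta_eq_one {X : MarkovChain S} (hX : X.IsAtom 1 Set.univ) {m : ℕ}
    (hm : 0 < m) (h : X.beta m = 1) : X.IsAtom m Set.univ := by
  obtain ⟨𝒞, h𝒞, hcard⟩ := exists_isBlackwell_of_beta_eq (n := 1) (by simpa using h)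
  obtain ⟨C, rfl⟩ := encard_eq_one.1 (by simpa using hcard)
  refine (h𝒞.isAtom_univ_or hm).resolve_right fun hnot => ?_
  obtain ⟨E, hE⟩ := hX.exists_isAtom hm
  exact hnot.1 E hE

/-- If the invariant events of the chain are trivial and `β(X^(m)) = m > 1`, then `X^(p)` is not
simple for any prime divisor `p` of `m`. -/
lemma IsAtom.beta_ne_one_of_prime {X : MarkovChain S} (hX : X.IsAtom 1 Set.univ) {m p : ℕ}
    (hm : 0 < m) (hβ : X.beta m = m) (hp : p.Prime) (hpm : p ∣ m) : X.beta p ≠ 1 := by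
  intro h
  obtain ⟨q, rfl⟩ := hpm
  rw [mul_comm] at hβ hm
  have hq : 0 < q := Nat.pos_of_mul_pos_right hm
  obtain ⟨𝒞, h𝒞, hcard⟩ := exists_isBlackwell_of_beta_eq hβ
  have hle := h𝒞.encard_le hq (hX.isAtom_univ_of_beta_eq_one hp.pos h)
  rw [hcard, Nat.cast_le] at hle
  exact absurd hle (not_le.2 (lt_mul_of_one_lt_right hq hp.one_lt))

lemma forall_beta_eq_one_of_period_eq_one {X : MarkovChain S} (hirr : X.Irreducible)
    (hap : X.Aperiodic) (hX : X.IsAtom 1 Set.univ) (hper : X.period = 1) {m : ℕ} (hm : 0 < m) :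
    X.beta m = 1 := by
  have h1 : X.beta 1 = 1 := hX.isBlackwell_univ.beta_eq_one
  refine IsBlackwell.beta_eq_one (C := Set.univ) (IsAtom.isBlackwell_univ ?_)
  induction m using Nat.strong_induction_on with
  | _ m ih =>
    by_contra hnot
    have hm1 : 1 < m := by
      refine lt_of_le_of_ne hm fun h => hnot ?_
      rwa [← h]
    exact (period_eq_one_iff h1).1 hper m hm1
      (beta_eq_self hirr hap hm1 hnot fun d hd hdm => ih d hdm hd)

end AsymptoticPeriod

end MarkovChain
variable {S : Type} [MeasurableSpace S] [MeasurableSingletonClass S]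
  [Countable S] [Infinite S]

/-- For a simple Markov chain `X`, the following are equivalent:
(i) `X` is asymptotically aperiodic; (ii) `X^(m)` is simple for all `m > 1`;
(iii) `X^(m)` is simple for all prime numbers `m`. -/
theorem stmt11 (X : MarkovChain S) (hirr : X.Irreducible) (hap : X.Aperiodic)
    (hsimple : X.Simple) :
    (X.period = 1 ↔ ∀ m : ℕ, 1 < m → X.beta m = 1) ∧
    (X.period = 1 ↔ ∀ m : ℕ, Nat.Prime m → X.beta m = 1) := by
  obtain ⟨𝒞, h𝒞, hcard⟩ := MarkovChain.exists_isBlackwell_of_beta_eq (n := 1)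
    (hsimple.trans Nat.cast_one.symm)
  obtain ⟨C, rfl⟩ := encard_eq_one.1 (by simpa using hcard)
  rcases h𝒞.isAtom_univ_or one_pos with hX | ⟨hX, htr⟩
  · have h12 : X.period = 1 → ∀ m : ℕ, 0 < m → X.beta m = 1 := fun h m hm =>
      MarkovChain.forall_beta_eq_one_of_period_eq_one hirr hap hX h hm
    have h31 (h : ∀ m : ℕ, Nat.Prime m → X.beta m = 1) : X.period = 1 :=
      (MarkovChain.period_eq_one_iff hsimple).2 fun m hm hβ =>
        hX.beta_ne_one_of_prime (by omega) hβ (Nat.minFac_prime hm.ne') (Nat.minFac_dvd m)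
          (h _ (Nat.minFac_prime hm.ne'))
    exact ⟨⟨fun h m hm => h12 h m (by omega), fun h => h31 fun m hm => h m hm.one_lt⟩,
      fun h m hm => h12 h m hm.pos, h31⟩
  · have hβ (m : ℕ) (hm : 0 < m) : X.beta m = 1 :=
      h𝒞.beta_eq_one_of_forall_not_isAtom hirr hap hX htr hm
    have hper : X.period = 1 := (MarkovChain.period_eq_one_iff hsimple).2 fun m hm h => by
      rw [hβ m (by omega)] at h
      exact hm.ne (by exact_mod_cast h)
    exact ⟨⟨fun _ m hm => hβ m (by omega), fun _ => hper⟩, fun _ m hm => hβ m hm.pos,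
      fun _ => hper⟩
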